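/- arXiv:2106.10810 — 3 statements merged into one kernel-verified Lean document; each statement's English description precedes it below -/
import Mathlib

section
/- Let ABCD be a rectangle in the Euclidean plane with center I, and let P be a point in the plane such that each of the triangles PAB, PBC, PCD, PDA is nondegenerate. Let H_a, H_b, H_c, H_d be the orthocenters of triangles PAB, PBC, PCD, PDA respectively, let Q be the midpoint of H_a and H_c, and let R be the midpoint of H_b and H_d. Then the points Q, R and I are collinear. -/
open EuclideanGeometry
open scoped InnerProductSpace

noncomputable section

/-- The Euclidean plane. -/
abbrev Pt := EuclideanSpace ℝ (Fin 2)

/-- The orthocenter of the nondegenerate triangle `ABC`. -/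
noncomputable def ortho (A B C : Pt) (h : AffineIndependent ℝ ![A, B, C]) : Pt :=
  Affine.Triangle.orthocenter (⟨![A, B, C], h⟩ : Affine.Triangle ℝ Pt)

/-- In the plane, a point lying on two altitudes of a triangle is its orthocenter. -/
theorem eq_ortho_of_inner_eq_zero {A B C H : Pt} (h : AffineIndependent ℝ ![A, B, C])
    (hA : ⟪H - A, B - C⟫_ℝ = 0) (hB : ⟪H - B, A - C⟫_ℝ = 0) : ortho A B C h = H := by
  have hspan : affineSpan ℝ (Set.range ![A, B, C]) = ⊤ :=
    h.affineSpan_eq_top_iff_card_eq_finrank_add_one.2 (by simp)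
  have h0 : ({0}ᶜ : Set (Fin 3)) = {1, 2} := by ext i; fin_cases i <;> simp
  have h1 : ({1}ᶜ : Set (Fin 3)) = {0, 2} := by ext i; fin_cases i <;> simp
  symm
  refine Affine.Triangle.eq_orthocenter_of_forall_mem_altitude (i₁ := 0) (i₂ := 1)
    (by decide) ?_ ?_
  · rw [Affine.Simplex.altitude_def, hspan, inf_top_eq, h0, AffineSubspace.mem_mk',
      Set.image_pair, direction_affineSpan, vectorSpan_pair,
      Submodule.mem_orthogonal_singleton_iff_inner_left]
    exact hA
  · rw [Affine.Simplex.altitude_def, hspan, inf_top_eq, h1, AffineSubspace.mem_mk',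
      Set.image_pair, direction_affineSpan, vectorSpan_pair,
      Submodule.mem_orthogonal_singleton_iff_inner_left]
    exact hB

/-- The triangle on one side of a rectangle with center `O` and half-sides `u`, `v`:
nondegeneracy and the position of the orthocenter. -/
theorem ortho_rectangle_side {O u v P A B : Pt} {x y : ℝ} (huv : ⟪u, v⟫_ℝ = 0) (hv : v ≠ 0)
    (hP : P = O + x • u + y • v) (hA : A = O + u + v) (hB : B = O - u + v)
    (h : AffineIndependent ℝ ![P, A, B]) :
    y ≠ 1 ∧ ortho P A B h =
      O + x • u + (1 + (1 - x ^ 2) * ⟪u, u⟫_ℝ / ((y - 1) * ⟪v, v⟫_ℝ)) • v := by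
  have hy : y ≠ 1 := by
    rintro rfl
    rw [affineIndependent_iff_not_collinear_set] at h
    refine h ((collinear_iff_of_mem (p₀ := A) (by simp)).2 ⟨u, ?_⟩)
    simp only [Set.mem_insert_iff, Set.mem_singleton_iff, vadd_eq_add]
    rintro p (rfl | rfl | rfl)
    · exact ⟨x - 1, by rw [hP, hA]; module⟩
    · exact ⟨0, by simp⟩
    · exact ⟨-2, by rw [hB, hA]; module⟩
  have hy' : y - 1 ≠ 0 := sub_ne_zero.2 hy
  have hvv : ⟪v, v⟫_ℝ ≠ 0 := inner_self_ne_zero.2 hv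
  have hvu : ⟪v, u⟫_ℝ = 0 := by rw [real_inner_comm, huv]
  refine ⟨hy, eq_ortho_of_inner_eq_zero h ?_ ?_⟩
  · subst hP hA hB
    simp only [inner_add_left, inner_sub_left, inner_add_right, inner_sub_right,
      real_inner_smul_left, huv, hvu]
    ring
  · subst hP hA hB
    simp only [inner_add_left, inner_sub_left, inner_add_right, inner_sub_right,
      real_inner_smul_left, real_inner_smul_right, huv, hvu, real_inner_comm O]
    field_simp
    ring

/-- Two orthogonal nonzero vectors span the plane. -/
theorem exists_eq_smul_add_smul_of_inner_eq_zero {u v : Pt} (huv : ⟪u, v⟫_ℝ = 0) (hu : u ≠ 0)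
    (hv : v ≠ 0) (w : Pt) : ∃ x y : ℝ, w = x • u + y • v := by
  have hli : LinearIndependent ℝ ![u, v] := by
    refine linearIndependent_of_ne_zero_of_inner_eq_zero (𝕜 := ℝ) ?_ ?_
    · intro i; fin_cases i <;> simpa
    · intro i j hij
      fin_cases i <;> fin_cases j <;> simp_all [real_inner_comm]
  have hspan := hli.span_eq_top_of_card_eq_finrank (by simp)
  have hw : w ∈ Submodule.span ℝ (Set.range ![u, v]) := hspan ▸ Submodule.mem_top
  rw [Matrix.range_cons, Matrix.range_cons, Matrix.range_empty, Set.union_empty,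
    Set.singleton_union, Submodule.mem_span_pair] at hw
  obtain ⟨x, y, h⟩ := hw
  exact ⟨x, y, h.symm⟩

/-- Let `ABCD` be a rectangle with center `I` and `P` a point such that the
triangles `PAB`, `PBC`, `PCD`, `PDA` are nondegenerate, with orthocenters `Hₐ`, `H_b`,
`H_c`, `H_d` respectively.  If `Q` is the midpoint of `Hₐ` and `H_c` and `R` is the midpoint
of `H_b` and `H_d`, then `Q`, `R`, `I` are collinear. -/
theorem rectangle_orthocenter_midpoints_collinear (A B C D I P : Pt)
    (hpar : A - B = D - C) (hperp : ⟪B - A, C - B⟫_ℝ = 0)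
    (hAB : A ≠ B) (hBC : B ≠ C)
    (hI : I = midpoint ℝ A C)
    (h₁ : AffineIndependent ℝ ![P, A, B]) (h₂ : AffineIndependent ℝ ![P, B, C])
    (h₃ : AffineIndependent ℝ ![P, C, D]) (h₄ : AffineIndependent ℝ ![P, D, A])
    (Ha Hb Hc Hd Q R : Pt)
    (hHa : Ha = ortho P A B h₁) (hHb : Hb = ortho P B C h₂)
    (hHc : Hc = ortho P C D h₃) (hHd : Hd = ortho P D A h₄)
    (hQ : Q = midpoint ℝ Ha Hc) (hR : R = midpoint ℝ Hb Hd) :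
    Collinear ℝ ({Q, R, I} : Set Pt) := by
  obtain ⟨u, hu⟩ : ∃ u : Pt, u = (1 / 2 : ℝ) • (A - B) := ⟨_, rfl⟩
  obtain ⟨v, hv⟩ : ∃ v : Pt, v = (1 / 2 : ℝ) • (B - C) := ⟨_, rfl⟩
  have hu0 : u ≠ 0 := by
    rw [hu]; exact smul_ne_zero (by norm_num) (sub_ne_zero.2 hAB)
  have hv0 : v ≠ 0 := by
    rw [hv]; exact smul_ne_zero (by norm_num) (sub_ne_zero.2 hBC)
  have huv : ⟪u, v⟫_ℝ = 0 := by
    rw [hu, hv, real_inner_smul_left, real_inner_smul_right, ← neg_sub B A, ← neg_sub C B,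
      inner_neg_neg, hperp]
    simp
  have hvu : ⟪v, u⟫_ℝ = 0 := by rw [real_inner_comm, huv]
  obtain ⟨x, y, hxy⟩ := exists_eq_smul_add_smul_of_inner_eq_zero huv hu0 hv0 (P - I)
  have hP : P = I + x • u + y • v := by rw [add_assoc, ← hxy]; abel
  have hI' : I = (1 / 2 : ℝ) • (A + C) := by
    rw [hI, midpoint_eq_smul_add, invOf_eq_inv, one_div]
  have hA : A = I + u + v := by rw [hI', hu, hv]; module
  have hB : B = I - u + v := by rw [hI', hu, hv]; module
  have hC : C = I - u - v := by rw [hI', hu, hv]; module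
  have hD : D = I + u - v := by
    rw [eq_add_of_sub_eq hpar.symm, hI', hu, hv]; module
  obtain ⟨hy, ea⟩ := ortho_rectangle_side huv hv0 hP hA hB h₁
  obtain ⟨hx, eb⟩ := ortho_rectangle_side (O := I) (u := v) (v := -u) (x := y) (y := -x)
    (by simp [hvu]) (by simpa) (by rw [hP]; module) (by rw [hB]; module)
    (by rw [hC]; module) h₂
  obtain ⟨hy', ec⟩ := ortho_rectangle_side (O := I) (u := -u) (v := -v) (x := -x) (y := -y)
    (by simp [huv]) (by simpa) (by rw [hP]; module) (by rw [hC]; module)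
    (by rw [hD]; module) h₃
  obtain ⟨hx', ed⟩ := ortho_rectangle_side (O := I) (u := -v) (v := u) (x := -y) (y := x)
    (by simp [hvu]) hu0 (by rw [hP]; module) (by rw [hD]; module)
    (by rw [hA]; module) h₄
  have hx1 : x + 1 ≠ 0 := fun h => hx (by linarith)
  have hx2 : x - 1 ≠ 0 := sub_ne_zero.2 hx'
  have hy1 : y + 1 ≠ 0 := fun h => hy' (by linarith)
  have hy2 : y - 1 ≠ 0 := sub_ne_zero.2 hy
  have huu : ⟪u, u⟫_ℝ ≠ 0 := inner_self_ne_zero.2 hu0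
  have hvv : ⟪v, v⟫_ℝ ≠ 0 := inner_self_ne_zero.2 hv0
  simp only [inner_neg_neg] at eb ec ed
  obtain ⟨k, hk⟩ : ∃ k : ℝ,
      k = (1 - x ^ 2) * ⟪u, u⟫_ℝ / ((y ^ 2 - 1) * ⟪v, v⟫_ℝ) := ⟨_, rfl⟩
  have hQ' : Q = x • u + (k * y) • v + I := by
    rw [hQ, midpoint_eq_smul_add, hHa, hHc, ea, ec, invOf_eq_inv]
    have : k * y = 1 / 2 * ((1 - x ^ 2) * ⟪u, u⟫_ℝ / ((y - 1) * ⟪v, v⟫_ℝ)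
        - (1 - (-x) ^ 2) * ⟪u, u⟫_ℝ / ((-y - 1) * ⟪v, v⟫_ℝ)) := by
      rw [hk, show y ^ 2 - 1 = (y - 1) * (y + 1) by ring,
        show -y - 1 = -(y + 1) by ring]
      field_simp
      ring
    rw [this]
    module
  have hR' : R = (k⁻¹ * x) • u + y • v + I := by
    rw [hR, midpoint_eq_smul_add, hHb, hHd, eb, ed, invOf_eq_inv]
    have : k⁻¹ * x = 1 / 2 * ((1 - (-y) ^ 2) * ⟪v, v⟫_ℝ / ((x - 1) * ⟪u, u⟫_ℝ)
        - (1 - y ^ 2) * ⟪v, v⟫_ℝ / ((-x - 1) * ⟪u, u⟫_ℝ)) := by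
      rw [hk, inv_div, show 1 - x ^ 2 = -((x - 1) * (x + 1)) by ring,
        show -x - 1 = -(x + 1) by ring]
      field_simp
      ring
    rw [this]
    module
  have hk0 : k ≠ 0 := by
    rw [hk, show 1 - x ^ 2 = -((x - 1) * (x + 1)) by ring,
      show y ^ 2 - 1 = (y - 1) * (y + 1) by ring]
    exact div_ne_zero (mul_ne_zero (neg_ne_zero.2 (mul_ne_zero hx2 hx1)) huu)
      (mul_ne_zero (mul_ne_zero hy2 hy1) hvv)
  refine (collinear_iff_of_mem (p₀ := I) (by simp)).2 ⟨R - I, ?_⟩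
  simp only [Set.mem_insert_iff, Set.mem_singleton_iff, vadd_eq_add]
  rintro p (rfl | rfl | rfl)
  · refine ⟨k, ?_⟩
    rw [hQ', hR', add_sub_cancel_right, smul_add, smul_smul, smul_smul,
      mul_inv_cancel_left₀ hk0]
  · exact ⟨1, by simp⟩
  · exact ⟨0, by simp⟩
end
end

section
/- Let ABCD be a rectangle in the Euclidean plane with center I, and let P be a point in the plane such that each of the triangles PAB, PBC, PCD, PDA is nondegenerate. Let O_a, O_b, O_c, O_d be the circumcenters of triangles PAB, PBC, PCD, PDA respectively, let Q be the midpoint of O_a and O_c, let R be the midpoint of O_b and O_d, and let S be the midpoint of Q and R. Assume the triangles PO_aO_c and PO_bO_d are nondegenerate, and let T be a point with T ≠ P lying on the circumcircle of triangle PO_aO_c and on the circumcircle of triangle PO_bO_d (i.e. T is equidistant from the circumcenter of PO_aO_c as P is, and likewise for PO_bO_d). Then the points S, T and I are collinear. -/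
open EuclideanGeometry
open scoped InnerProductSpace

noncomputable section

/-- The circumcenter of the nondegenerate triangle `ABC`. -/
noncomputable def circum (A B C : Pt) (h : AffineIndependent ℝ ![A, B, C]) : Pt :=
  (⟨![A, B, C], h⟩ : Affine.Triangle ℝ Pt).circumcenter

/-- The rectangle configuration in coordinates centred at `I` and parallel to the sides. The four
circumcenters lie on the axes, and `(c, q)`, `(r, d)` are the centers of the two circles through
`P = (x, y)` and `T = (X, Y)`. -/
lemma second_intersection_on_line {a b x y s s' t t' c d q r X Y : ℝ}
    (hyb : y + b ≠ 0) (hyb' : y - b ≠ 0) (hxa : x - a ≠ 0) (hxa' : x + a ≠ 0)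
    (hx : x ≠ 0) (hy : y ≠ 0) (hw : x ^ 2 + y ^ 2 - a ^ 2 - b ^ 2 ≠ 0)
    (hs : 2 * s * (y + b) = x ^ 2 + y ^ 2 - a ^ 2 - b ^ 2)
    (hs' : 2 * s' * (y - b) = x ^ 2 + y ^ 2 - a ^ 2 - b ^ 2)
    (ht : 2 * t * (x - a) = x ^ 2 + y ^ 2 - a ^ 2 - b ^ 2)
    (ht' : 2 * t' * (x + a) = x ^ 2 + y ^ 2 - a ^ 2 - b ^ 2)
    (hq : 2 * q = s + s') (hr : 2 * r = t + t')
    (hc : 2 * c * x = x ^ 2 + y ^ 2 - 2 * q * y + s * s')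
    (hd : 2 * d * y = x ^ 2 + y ^ 2 - 2 * r * x + t * t')
    (hT : X ≠ x ∨ Y ≠ y)
    (h₁ : (X - c) ^ 2 + (Y - q) ^ 2 = (x - c) ^ 2 + (y - q) ^ 2)
    (h₂ : (X - r) ^ 2 + (Y - d) ^ 2 = (x - r) ^ 2 + (y - d) ^ 2) :
    r * Y - q * X = 0 := by
  have hδ : (c - r) ^ 2 + (q - d) ^ 2 ≠ 0 := by
    intro h
    have hcr : c = r := by
      rw [← sub_eq_zero, ← sq_eq_zero_iff]; linarith [sq_nonneg (c - r), sq_nonneg (q - d)]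
    have hqd : q = d := by
      rw [← sub_eq_zero, ← sq_eq_zero_iff]; linarith [sq_nonneg (c - r), sq_nonneg (q - d)]
    subst hcr hqd
    have hst : s * s' = t * t' := by linarith
    have hD : (x ^ 2 + y ^ 2 - a ^ 2 - b ^ 2) ^ 2 * ((x ^ 2 - a ^ 2) - (y ^ 2 - b ^ 2)) = 0 := by
      have e₁ : 4 * (s * s') * (y ^ 2 - b ^ 2) = (x ^ 2 + y ^ 2 - a ^ 2 - b ^ 2) ^ 2 := by
        linear_combination (2 * s' * (y - b)) * hs + (x ^ 2 + y ^ 2 - a ^ 2 - b ^ 2) * hs'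
      have e₂ : 4 * (t * t') * (x ^ 2 - a ^ 2) = (x ^ 2 + y ^ 2 - a ^ 2 - b ^ 2) ^ 2 := by
        linear_combination (2 * t' * (x + a)) * ht + (x ^ 2 + y ^ 2 - a ^ 2 - b ^ 2) * ht'
      linear_combination (y ^ 2 - b ^ 2) * e₂ - (x ^ 2 - a ^ 2) * e₁
        + 4 * (x ^ 2 - a ^ 2) * (y ^ 2 - b ^ 2) * hst
    have hD' : x ^ 2 - a ^ 2 = y ^ 2 - b ^ 2 := by
      have := (mul_eq_zero.mp hD).resolve_left (pow_ne_zero 2 hw)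
      linarith
    have hs₁ : s = y - b := by
      apply mul_right_cancel₀ hyb; linarith
    have hs₂ : s' = y + b := by
      apply mul_right_cancel₀ hyb'; linarith
    have ht₁ : t = x + a := by
      apply mul_right_cancel₀ hxa; linarith
    have ht₂ : t' = x - a := by
      apply mul_right_cancel₀ hxa'; linarith
    subst hs₁ hs₂ ht₁ ht₂
    have hq' : q = y := by linarith
    have hc' : c = x := by linarith
    subst hq' hc'
    have : 0 < c ^ 2 := by positivity
    nlinarith [sq_nonneg b]
  have hV : ¬(X = x ∧ Y = y) := by tauto
  have hperp : (X - x) * (c - r) + (Y - y) * (q - d) = 0 := by linarith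
  obtain ⟨τ, hX, hY⟩ : ∃ τ, X = x - τ * (q - d) ∧ Y = y + τ * (c - r) := by
    refine ⟨((Y - y) * (c - r) - (X - x) * (q - d)) / ((c - r) ^ 2 + (q - d) ^ 2), ?_, ?_⟩
    · field_simp
      linear_combination (c - r) * hperp
    · field_simp
      linear_combination (q - d) * hperp
  subst hX hY
  have hτ : τ ≠ 0 := by
    rintro rfl
    simp at hV
  have hτδ : τ * ((c - r) ^ 2 + (q - d) ^ 2)
      = 2 * ((c - r) * (q - y) - (q - d) * (c - x)) := by
    apply mul_left_cancel₀ hτ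
    linear_combination h₁
  apply (mul_eq_zero.mp _).resolve_left hδ
  have key : ((c - r) ^ 2 + (q - d) ^ 2) * (r * y - q * x)
      + 2 * ((c - r) * (q - y) - (q - d) * (c - x)) * (r * (c - r) + q * (q - d)) = 0 := by
    obtain ⟨D, hD⟩ : ∃ D, D = (y + b) * (y - b) := ⟨_, rfl⟩
    obtain ⟨E, hE⟩ : ∃ E, E = (x - a) * (x + a) := ⟨_, rfl⟩
    have hD0 : D ≠ 0 := hD ▸ mul_ne_zero hyb hyb'
    have hE0 : E ≠ 0 := hE ▸ mul_ne_zero hxa hxa'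
    have hw' : x ^ 2 + y ^ 2 - a ^ 2 - b ^ 2 = D + E := by rw [hD, hE]; ring
    rw [hw'] at hs hs' ht ht'
    have hss : s * s' = (D + E) ^ 2 / (4 * D) := by
      rw [eq_div_iff (by positivity)]
      linear_combination (2 * s' * (y - b)) * hs + (D + E) * hs' + 4 * s * s' * hD
    have htt : t * t' = (D + E) ^ 2 / (4 * E) := by
      rw [eq_div_iff (by positivity)]
      linear_combination (2 * t' * (x + a)) * ht + (D + E) * ht' + 4 * t * t' * hE
    have hq' : q = (D + E) * y / (2 * D) := by
      rw [eq_div_iff (by positivity)]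
      linear_combination D * hq + (s + s') * hD + (y - b) / 2 * hs + (y + b) / 2 * hs'
    have hr' : r = (D + E) * x / (2 * E) := by
      rw [eq_div_iff (by positivity)]
      linear_combination E * hr + (t + t') * hE + (x + a) / 2 * ht + (x - a) / 2 * ht'
    have hc' : c = (x ^ 2 + y ^ 2 - 2 * q * y + s * s') / (2 * x) := by
      rw [eq_div_iff (by positivity)]; linear_combination hc
    have hd' : d = (x ^ 2 + y ^ 2 - 2 * r * x + t * t') / (2 * y) := by
      rw [eq_div_iff (by positivity)]; linear_combination hd
    rw [hc', hd', hss, htt, hq', hr']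
    field_simp
    ring
  linear_combination key + (r * (c - r) + q * (q - d)) * hτδ

lemma normSq_ne_zero {u : Pt} (hu : u ≠ 0) : u 0 ^ 2 + u 1 ^ 2 ≠ 0 := by
  intro h
  apply hu
  ext i
  rw [PiLp.zero_apply, ← sq_eq_zero_iff]
  fin_cases i <;> simp only [Fin.zero_eta, Fin.mk_one] <;>
    linarith [sq_nonneg (u 0), sq_nonneg (u 1)]

/-- Twice the signed area of the triangle `XYZ`. -/
def doubleArea (X Y Z : Pt) : ℝ :=
  (X 0 - Z 0) * (Y 1 - Z 1) - (X 1 - Z 1) * (Y 0 - Z 0)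

lemma collinear_of_doubleArea_eq_zero {X Y Z : Pt} (h : doubleArea X Y Z = 0) :
    Collinear ℝ ({X, Y, Z} : Set Pt) := by
  unfold doubleArea at h
  by_cases hYZ : Y = Z
  · subst hYZ
    simpa using collinear_pair ℝ X Y
  rw [collinear_iff_of_mem (p₀ := Z) (by simp)]
  have hN : (Y 0 - Z 0) ^ 2 + (Y 1 - Z 1) ^ 2 ≠ 0 := by
    simpa using normSq_ne_zero (sub_ne_zero.mpr hYZ)
  refine ⟨Y - Z, ?_⟩
  rintro p (rfl | rfl | rfl)
  · refine ⟨((p 0 - Z 0) * (Y 0 - Z 0) + (p 1 - Z 1) * (Y 1 - Z 1)) /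
      ((Y 0 - Z 0) ^ 2 + (Y 1 - Z 1) ^ 2), ?_⟩
    ext i
    fin_cases i <;> simp <;> field_simp
    · linear_combination (Y 1 - Z 1) * h
    · linear_combination -(Y 0 - Z 0) * h
  · exact ⟨1, by simp⟩
  · exact ⟨0, by simp⟩

lemma doubleArea_ne_zero {X Y Z : Pt} (h : AffineIndependent ℝ ![X, Y, Z]) :
    doubleArea X Y Z ≠ 0 := fun h0 ↦
  affineIndependent_iff_not_collinear_set.mp h (collinear_of_doubleArea_eq_zero h0)

lemma dist_eq_dist_iff_coord {X Y O : Pt} :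
    dist X O = dist Y O ↔
      (X 0 - O 0) ^ 2 + (X 1 - O 1) ^ 2 = (Y 0 - O 0) ^ 2 + (Y 1 - O 1) ^ 2 := by
  rw [← sq_eq_sq₀ dist_nonneg dist_nonneg, EuclideanSpace.dist_sq_eq, EuclideanSpace.dist_sq_eq]
  simp [Fin.sum_univ_two, Real.dist_eq, sq_abs]

lemma dist_circum (A B C : Pt) (h : AffineIndependent ℝ ![A, B, C]) :
    dist A (circum A B C h) = dist B (circum A B C h) ∧
      dist A (circum A B C h) = dist C (circum A B C h) := by
  have key := (⟨![A, B, C], h⟩ : Affine.Triangle ℝ Pt).dist_circumcenter_eq_circumradius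
  have h0 := key 0
  have h1 := key 1
  have h2 := key 2
  exact ⟨h0.trans h1.symm, h0.trans h2.symm⟩

lemma midpoint_coord (X Y : Pt) (i : Fin 2) : midpoint ℝ X Y i = (X i + Y i) / 2 := by
  simp [midpoint_eq_smul_add]
  ring

/-- The first coordinate of `X` in the orthogonal frame at `I` with first axis `u`. -/
def frameX (I u X : Pt) : ℝ := (X 0 - I 0) * u 0 + (X 1 - I 1) * u 1

/-- The second coordinate of `X` in the orthogonal frame at `I` with first axis `u`. -/
def frameY (I u X : Pt) : ℝ := (X 1 - I 1) * u 0 - (X 0 - I 0) * u 1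

lemma frame_dist (I u : Pt) {X Y O : Pt} (h : dist X O = dist Y O) :
    (frameX I u X - frameX I u O) ^ 2 + (frameY I u X - frameY I u O) ^ 2
      = (frameX I u Y - frameX I u O) ^ 2 + (frameY I u Y - frameY I u O) ^ 2 := by
  rw [dist_eq_dist_iff_coord] at h
  unfold frameX frameY
  linear_combination (u 0 ^ 2 + u 1 ^ 2) * h

lemma frame_doubleArea (I u X Y Z : Pt) :
    (frameX I u X - frameX I u Z) * (frameY I u Y - frameY I u Z)
      - (frameY I u X - frameY I u Z) * (frameX I u Y - frameX I u Z)
      = (u 0 ^ 2 + u 1 ^ 2) * doubleArea X Y Z := by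
  unfold frameX frameY doubleArea
  ring

lemma frame_midpoint (I u X Y : Pt) :
    frameX I u (midpoint ℝ X Y) = (frameX I u X + frameX I u Y) / 2 ∧
      frameY I u (midpoint ℝ X Y) = (frameY I u X + frameY I u Y) / 2 := by
  unfold frameX frameY
  rw [midpoint_coord, midpoint_coord]
  constructor <;> ring

/-- The center of a circle through `(x, y)`, `(-a, h)` and `(a, h)`. -/
lemma center_on_axis {a h x y o₁ o₂ : ℝ} (ha : a ≠ 0)
    (e₁ : (x - o₁) ^ 2 + (y - o₂) ^ 2 = (-a - o₁) ^ 2 + (h - o₂) ^ 2)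
    (e₂ : (x - o₁) ^ 2 + (y - o₂) ^ 2 = (a - o₁) ^ 2 + (h - o₂) ^ 2) :
    o₁ = 0 ∧ 2 * o₂ * (y - h) = x ^ 2 + y ^ 2 - a ^ 2 - h ^ 2 := by
  have h₁ : o₁ = 0 := by
    apply (mul_eq_zero.mp _).resolve_left ha
    linear_combination (e₂ - e₁) / 4
  subst h₁
  exact ⟨rfl, by linear_combination -e₁⟩

/-- The center of a circle through `(x, y)`, `(0, s)` and `(0, s')`. -/
lemma center_of_axis_points {x y s s' c q : ℝ} (h : s ≠ s')
    (e₁ : (x - c) ^ 2 + (y - q) ^ 2 = (0 - c) ^ 2 + (s - q) ^ 2)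
    (e₂ : (x - c) ^ 2 + (y - q) ^ 2 = (0 - c) ^ 2 + (s' - q) ^ 2) :
    2 * q = s + s' ∧ 2 * c * x = x ^ 2 + y ^ 2 - 2 * q * y + s * s' := by
  have h₁ : 2 * q = s + s' := by
    apply mul_left_cancel₀ (sub_ne_zero.mpr h)
    linear_combination e₁ - e₂
  exact ⟨h₁, by linear_combination -e₁ + s * h₁⟩

/-- Let `ABCD` be a rectangle with center `I` and `P` a point such that the
triangles `PAB`, `PBC`, `PCD`, `PDA` are nondegenerate with circumcenters `Oₐ`, `O_b`,
`O_c`, `O_d`.  Let `Q`, `R`, `S` be the midpoints of `OₐO_c`, `O_bO_d`, `QR`.  If `T ≠ P`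
lies on the circumcircles of both (nondegenerate) triangles `POₐO_c` and `PO_bO_d`, then
`S`, `T`, `I` are collinear. -/
theorem rectangle_circumcenters_second_intersection_collinear (A B C D I P : Pt)
    (hpar : A - B = D - C) (hperp : ⟪B - A, C - B⟫_ℝ = 0)
    (hAB : A ≠ B) (hBC : B ≠ C)
    (hI : I = midpoint ℝ A C)
    (h₁ : AffineIndependent ℝ ![P, A, B]) (h₂ : AffineIndependent ℝ ![P, B, C])
    (h₃ : AffineIndependent ℝ ![P, C, D]) (h₄ : AffineIndependent ℝ ![P, D, A])
    (Oa Ob Oc Od Q R S T : Pt)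
    (hOa : Oa = circum P A B h₁) (hOb : Ob = circum P B C h₂)
    (hOc : Oc = circum P C D h₃) (hOd : Od = circum P D A h₄)
    (hQ : Q = midpoint ℝ Oa Oc) (hR : R = midpoint ℝ Ob Od) (hS : S = midpoint ℝ Q R)
    (hac : AffineIndependent ℝ ![P, Oa, Oc]) (hbd : AffineIndependent ℝ ![P, Ob, Od])
    (hTP : T ≠ P)
    (hT₁ : dist T (circum P Oa Oc hac) = dist P (circum P Oa Oc hac))
    (hT₂ : dist T (circum P Ob Od hbd) = dist P (circum P Ob Od hbd)) :
    Collinear ℝ ({S, T, I} : Set Pt) := by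
  set u : Pt := B - A with hu
  have hN : u 0 ^ 2 + u 1 ^ 2 ≠ 0 := normSq_ne_zero (sub_ne_zero.mpr hAB.symm)
  obtain ⟨a, hadef⟩ : ∃ a, a = (u 0 ^ 2 + u 1 ^ 2) / 2 := ⟨_, rfl⟩
  obtain ⟨b, hbdef⟩ : ∃ b, b = ((C 1 - B 1) * u 0 - (C 0 - B 0) * u 1) / 2 := ⟨_, rfl⟩
  have hu0 : u 0 = B 0 - A 0 := by simp [hu]
  have hu1 : u 1 = B 1 - A 1 := by simp [hu]
  have hD0 : D 0 = A 0 - B 0 + C 0 := by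
    have := congrArg (· 0) hpar
    simp at this
    linarith
  have hD1 : D 1 = A 1 - B 1 + C 1 := by
    have := congrArg (· 1) hpar
    simp at this
    linarith
  have hp : (B 0 - A 0) * (C 0 - B 0) + (B 1 - A 1) * (C 1 - B 1) = 0 := by
    simp [PiLp.inner_apply, Fin.sum_univ_two, hu] at hperp
    linarith
  have hI0 : I 0 = (A 0 + C 0) / 2 := by rw [hI, midpoint_coord]
  have hI1 : I 1 = (A 1 + C 1) / 2 := by rw [hI, midpoint_coord]
  have ha : a ≠ 0 := by rw [hadef]; exact div_ne_zero hN two_ne_zero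
  have hAx : frameX I u A = -a := by
    rw [frameX, hadef, hI0, hI1, hu0, hu1]; linear_combination -hp / 2
  have hBx : frameX I u B = a := by
    rw [frameX, hadef, hI0, hI1, hu0, hu1]; linear_combination -hp / 2
  have hCx : frameX I u C = a := by
    rw [frameX, hadef, hI0, hI1, hu0, hu1]; linear_combination hp / 2
  have hDx : frameX I u D = -a := by
    rw [frameX, hadef, hD0, hD1, hI0, hI1, hu0, hu1]; linear_combination hp / 2
  have hAy : frameY I u A = -b := by
    rw [frameY, hbdef, hI0, hI1, hu0, hu1]; ring
  have hBy : frameY I u B = -b := by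
    rw [frameY, hbdef, hI0, hI1, hu0, hu1]; ring
  have hCy : frameY I u C = b := by
    rw [frameY, hbdef, hI0, hI1, hu0, hu1]; ring
  have hDy : frameY I u D = b := by
    rw [frameY, hbdef, hD0, hD1, hI0, hI1, hu0, hu1]; ring
  have area {X Y Z : Pt} (h : AffineIndependent ℝ ![X, Y, Z]) :=
    frame_doubleArea I u X Y Z ▸ mul_ne_zero hN (doubleArea_ne_zero h)
  have n₁ := area h₁
  have n₂ := area h₂
  have n₃ := area h₃
  have n₄ := area h₄
  have nac := area hac
  have nbd := area hbd
  obtain ⟨a₁, a₂⟩ := dist_circum P A B h₁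
  obtain ⟨b₁, b₂⟩ := dist_circum P B C h₂
  obtain ⟨c₁, c₂⟩ := dist_circum P C D h₃
  obtain ⟨d₁, d₂⟩ := dist_circum P D A h₄
  obtain ⟨k₁, k₂⟩ := dist_circum P Oa Oc hac
  obtain ⟨l₁, l₂⟩ := dist_circum P Ob Od hbd
  rw [← hOa] at a₁ a₂
  rw [← hOb] at b₁ b₂
  rw [← hOc] at c₁ c₂
  rw [← hOd] at d₁ d₂
  generalize circum P Oa Oc hac = K at *
  generalize circum P Ob Od hbd = L at *
  replace a₁ := frame_dist I u a₁
  replace a₂ := frame_dist I u a₂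
  replace b₁ := frame_dist I u b₁
  replace b₂ := frame_dist I u b₂
  replace c₁ := frame_dist I u c₁
  replace c₂ := frame_dist I u c₂
  replace d₁ := frame_dist I u d₁
  replace d₂ := frame_dist I u d₂
  replace k₁ := frame_dist I u k₁
  replace k₂ := frame_dist I u k₂
  replace l₁ := frame_dist I u l₁
  replace l₂ := frame_dist I u l₂
  have t₁ := frame_dist I u hT₁
  have t₂ := frame_dist I u hT₂
  simp only [hAx, hBx, hCx, hDx, hAy, hBy, hCy, hDy] at n₁ n₂ n₃ n₄ a₁ a₂ b₁ b₂ c₁ c₂ d₁ d₂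
  have hTP' : frameX I u T ≠ frameX I u P ∨ frameY I u T ≠ frameY I u P := by
    by_contra! h
    obtain ⟨hx, hy⟩ := h
    unfold frameX at hx
    unfold frameY at hy
    apply hTP
    ext i
    apply mul_left_cancel₀ hN
    fin_cases i
    · simp only [Fin.zero_eta]
      linear_combination u 0 * hx - u 1 * hy
    · simp only [Fin.mk_one]
      linear_combination u 1 * hx + u 0 * hy
  have hIx : frameX I u I = 0 := by simp [frameX]
  have hIy : frameY I u I = 0 := by simp [frameY]
  apply collinear_of_doubleArea_eq_zero
  apply (mul_eq_zero.mp _).resolve_left hN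
  rw [← frame_doubleArea I u, hIx, hIy, hS, (frame_midpoint I u Q R).1, (frame_midpoint I u Q R).2,
    hQ, hR, (frame_midpoint I u Oa Oc).1, (frame_midpoint I u Oa Oc).2,
    (frame_midpoint I u Ob Od).1, (frame_midpoint I u Ob Od).2]
  have hb : b ≠ 0 := by
    rintro rfl
    have hv : (C 0 - B 0) ^ 2 + (C 1 - B 1) ^ 2 ≠ 0 := by
      simpa using normSq_ne_zero (sub_ne_zero.mpr hBC.symm)
    apply mul_ne_zero hN hv
    rw [hu0, hu1] at *
    linear_combination ((B 0 - A 0) * (C 0 - B 0) + (B 1 - A 1) * (C 1 - B 1)) * hp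
      - 2 * ((C 1 - B 1) * (B 0 - A 0) - (C 0 - B 0) * (B 1 - A 1)) * hbdef
  obtain ⟨za, sa⟩ := center_on_axis ha a₁ a₂
  obtain ⟨zc, sc⟩ := center_on_axis ha c₂ c₁
  obtain ⟨zb, sb⟩ := center_on_axis hb ((add_comm _ _).trans (b₁.trans (add_comm _ _)))
    ((add_comm _ _).trans (b₂.trans (add_comm _ _)))
  obtain ⟨zd, sd⟩ := center_on_axis hb ((add_comm _ _).trans (d₂.trans (add_comm _ _)))
    ((add_comm _ _).trans (d₁.trans (add_comm _ _)))
  rw [za, zc] at nac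
  rw [zb, zd] at nbd
  rw [za] at k₁
  rw [zc] at k₂
  rw [zb] at l₁
  rw [zd] at l₂
  rw [za, zb, zc, zd]
  generalize frameX I u P = x at *
  generalize frameY I u P = y at *
  have hs : frameY I u Oa ≠ frameY I u Oc := by
    intro h
    apply nac
    rw [h]; ring
  have ht : frameX I u Ob ≠ frameX I u Od := by
    intro h
    apply nbd
    rw [h]; ring
  obtain ⟨hq, hc⟩ := center_of_axis_points hs k₁ k₂
  obtain ⟨hr, hd⟩ := center_of_axis_points ht ((add_comm _ _).trans (l₁.trans (add_comm _ _)))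
    ((add_comm _ _).trans (l₂.trans (add_comm _ _)))
  have hyb : y + b ≠ 0 := fun h ↦ n₁ (by linear_combination 2 * a * h)
  have hyb' : y - b ≠ 0 := fun h ↦ n₃ (by linear_combination -2 * a * h)
  have hxa : x - a ≠ 0 := fun h ↦ n₂ (by linear_combination -2 * b * h)
  have hxa' : x + a ≠ 0 := fun h ↦ n₄ (by linear_combination 2 * b * h)
  have hx : x ≠ 0 := by
    rintro rfl
    apply nac
    ring
  have hy : y ≠ 0 := by
    rintro rfl
    apply nbd
    ring
  have hw : x ^ 2 + y ^ 2 - a ^ 2 - b ^ 2 ≠ 0 := by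
    intro hw
    apply hs
    have h₁ : frameY I u Oa = 0 := by
      apply (mul_eq_zero.mp _).resolve_right hyb
      linarith
    have h₂ : frameY I u Oc = 0 := by
      apply (mul_eq_zero.mp _).resolve_right hyb'
      linarith
    rw [h₁, h₂]
  have main := second_intersection_on_line hyb hyb' hxa hxa' hx hy hw
    (by linear_combination sa) (by linear_combination sc) (by linear_combination sb)
    (by linear_combination sd) hq hr hc (by linear_combination hd) hTP' t₁ t₂
  linear_combination main / 2 + frameX I u T / 4 * hq - frameY I u T / 4 * hr
end
end

section
/- Let ABCD be a rectangle in the Euclidean plane with center I, and let P be a point in the plane such that each of the triangles PAB, PBC, PCD, PDA is nondegenerate. Let N_a, N_b, N_c, N_d be the nine-point centers of triangles PAB, PBC, PCD, PDA respectively, let M be the midpoint of N_a and N_c, and let N be the midpoint of N_b and N_d. Assume N_a ≠ N_c and N_b ≠ N_d, and let Q be a point lying on the perpendicular bisector of the segment N_aN_c and on the perpendicular bisector of the segment N_bN_d. Then the line through M and N is parallel to the line through I and Q (i.e. the vector N - M is a scalar multiple of the vector Q - I, where we also assume M ≠ N and I ≠ Q). -/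
open EuclideanGeometry
open scoped InnerProductSpace

noncomputable section

/-- `N` is the nine-point center of the triangle `XYZ`: it is the circumcenter of the medial
triangle, i.e. the point equidistant from the midpoints of `YZ`, `ZX`, `XY` (this point is
unique in the plane when the triangle is nondegenerate). -/
def IsNinePointCenter (N X Y Z : Pt) : Prop :=
  dist N (midpoint ℝ Y Z) = dist N (midpoint ℝ Z X) ∧
    dist N (midpoint ℝ Y Z) = dist N (midpoint ℝ X Y)

/-- The point with coordinates `(x, y)` in the affine frame with origin `O` and axes `e`, `f`. -/
def framePoint (O e f : Pt) (x y : ℝ) : Pt := O + x • e + y • f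

theorem exists_eq_framePoint {e f : Pt} (he : e ≠ 0) (hf : f ≠ 0) (hef : ⟪e, f⟫_ℝ = 0)
    (O X : Pt) : ∃ x y : ℝ, X = framePoint O e f x y := by
  have hspan : Submodule.span ℝ (Set.range ![e, f]) = ⊤ := by
    apply LinearIndependent.span_eq_top_of_card_eq_finrank
    · apply linearIndependent_of_ne_zero_of_inner_eq_zero
      · intro i
        fin_cases i
        · exact he
        · exact hf
      · intro i j hij
        fin_cases i <;> fin_cases j
        · exact absurd rfl hij
        · exact hef
        · exact (real_inner_comm e f).trans hef
        · exact absurd rfl hij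
    · simp
  have hX : X - O ∈ Submodule.span ℝ {e, f} := by
    rw [← Matrix.range_cons_cons_empty e f ![], hspan]
    exact Submodule.mem_top
  obtain ⟨x, y, hxy⟩ := Submodule.mem_span_pair.mp hX
  refine ⟨x, y, ?_⟩
  rw [framePoint, add_assoc, hxy, add_sub_cancel]

theorem midpoint_framePoint (O e f : Pt) (x y x' y' : ℝ) :
    midpoint ℝ (framePoint O e f x y) (framePoint O e f x' y') =
      framePoint O e f ((x + x') / 2) ((y + y') / 2) := by
  rw [midpoint_eq_smul_add, framePoint, framePoint, framePoint, invOf_eq_inv]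
  module

theorem dist_framePoint_sq {e f : Pt} (hef : ⟪e, f⟫_ℝ = 0) (O : Pt) (x y x' y' : ℝ) :
    dist (framePoint O e f x y) (framePoint O e f x' y') ^ 2 =
      (x - x') ^ 2 * ‖e‖ ^ 2 + (y - y') ^ 2 * ‖f‖ ^ 2 := by
  have h : framePoint O e f x y - framePoint O e f x' y' = (x - x') • e + (y - y') • f := by
    rw [framePoint, framePoint]
    module
  rw [dist_eq_norm, h, norm_add_sq_real, inner_smul_left, inner_smul_right, hef,
    norm_smul, norm_smul, mul_pow, mul_pow, Real.norm_eq_abs, Real.norm_eq_abs, sq_abs, sq_abs]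
  ring

theorem dist_framePoint_eq_iff {e f : Pt} (hef : ⟪e, f⟫_ℝ = 0) (O : Pt)
    (x y x₁ y₁ x₂ y₂ : ℝ) :
    dist (framePoint O e f x y) (framePoint O e f x₁ y₁) =
        dist (framePoint O e f x y) (framePoint O e f x₂ y₂) ↔
      (x - x₁) ^ 2 * ‖e‖ ^ 2 + (y - y₁) ^ 2 * ‖f‖ ^ 2 =
        (x - x₂) ^ 2 * ‖e‖ ^ 2 + (y - y₂) ^ 2 * ‖f‖ ^ 2 := by
  rw [← dist_framePoint_sq hef O, ← dist_framePoint_sq hef O,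
    sq_eq_sq₀ dist_nonneg dist_nonneg]

theorem ne_lineMap_of_affineIndependent {P X Y : Pt} (h : AffineIndependent ℝ ![P, X, Y])
    (t : ℝ) : P ≠ AffineMap.lineMap X Y t := by
  rintro rfl
  rw [affineIndependent_iff_not_collinear_set] at h
  exact h (collinear_insert_of_mem_affineSpan_pair (AffineMap.lineMap_mem_affineSpan_pair t X Y))

theorem lineMap_framePoint (O e f : Pt) (x y x' y' t : ℝ) :
    AffineMap.lineMap (framePoint O e f x y) (framePoint O e f x' y') t =
      framePoint O e f (x + t * (x' - x)) (y + t * (y' - y)) := by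
  rw [AffineMap.lineMap_apply_module', framePoint, framePoint, framePoint]
  module

theorem framePoint_smul_eq {e f O : Pt} {t x y x₁ y₁ x₂ y₂ : ℝ}
    (hx : x₂ - x₁ = t * x) (hy : y₂ - y₁ = t * y) :
    framePoint O e f x₂ y₂ - framePoint O e f x₁ y₁ = t • (framePoint O e f x y - O) := by
  obtain rfl : x₂ = x₁ + t * x := by linarith
  obtain rfl : y₂ = y₁ + t * y := by linarith
  simp only [framePoint]
  module

/-- Coordinates of the point equidistant from the midpoints of the sides of the triangle with
vertices `(p, q)`, `(-1/2, s)`, `(1/2, s)`, for the quadratic form `E x² + F y²`. -/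
theorem ninePointCenter_coordinates {E F p q s x y : ℝ} (hE : E ≠ 0)
    (h₁ : (x - 0) ^ 2 * E + (y - s) ^ 2 * F =
      (x - (p - 1 / 2) / 2) ^ 2 * E + (y - (q + s) / 2) ^ 2 * F)
    (h₂ : (x - 0) ^ 2 * E + (y - s) ^ 2 * F =
      (x - (p + 1 / 2) / 2) ^ 2 * E + (y - (q + s) / 2) ^ 2 * F) :
    x = p / 2 ∧ F * (q - s) * (4 * y - q - 3 * s) = -(E * (p ^ 2 - 1 / 4)) := by
  have hx : x = p / 2 := mul_left_cancel₀ hE (by linear_combination h₂ - h₁)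
  refine ⟨hx, ?_⟩
  subst hx
  linear_combination 2 * (h₁ + h₂)

/-- The mean of the coordinates of the nine-point centers attached to two opposite sides. -/
theorem ninePointCenter_mean {F u q y y' : ℝ}
    (h₁ : F * (q - -(1 / 2)) * (4 * y - q - 3 * -(1 / 2)) = -u)
    (h₂ : F * (q - 1 / 2) * (4 * y' - q - 3 * (1 / 2)) = -u) :
    4 * (F * (q ^ 2 - 1 / 4)) * ((y + y') / 2) = q * (F * (q ^ 2 - 1 / 4) - u) := by
  linear_combination (q - 1 / 2) / 2 * h₁ + (q + 1 / 2) / 2 * h₂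

/-- Let `ABCD` be a rectangle with center `I` and `P` a point such that the
triangles `PAB`, `PBC`, `PCD`, `PDA` are nondegenerate, with nine-point centers `Nₐ`, `N_b`,
`N_c`, `N_d`.  Let `M`, `N` be the midpoints of `NₐN_c`, `N_bN_d`, and let `Q` lie on the
perpendicular bisectors of `NₐN_c` and of `N_bN_d`.  Then line `MN` is parallel to
line `IQ`. -/
theorem rectangle_ninePointCenters_parallel (A B C D I P : Pt)
    (hpar : A - B = D - C) (hperp : ⟪B - A, C - B⟫_ℝ = 0)
    (hAB : A ≠ B) (hBC : B ≠ C)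
    (hI : I = midpoint ℝ A C)
    (h₁ : AffineIndependent ℝ ![P, A, B]) (h₂ : AffineIndependent ℝ ![P, B, C])
    (h₃ : AffineIndependent ℝ ![P, C, D]) (h₄ : AffineIndependent ℝ ![P, D, A])
    (Na Nb Nc Nd M N Q : Pt)
    (hNa : IsNinePointCenter Na P A B) (hNb : IsNinePointCenter Nb P B C)
    (hNc : IsNinePointCenter Nc P C D) (hNd : IsNinePointCenter Nd P D A)
    (hM : M = midpoint ℝ Na Nc) (hN : N = midpoint ℝ Nb Nd)
    (hNac : Na ≠ Nc) (hNbd : Nb ≠ Nd)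
    (hQ₁ : dist Q Na = dist Q Nc) (hQ₂ : dist Q Nb = dist Q Nd)
    (hMN : M ≠ N) (hIQ : I ≠ Q) :
    ∃ t : ℝ, N - M = t • (Q - I) := by
  have he : B - A ≠ 0 := sub_ne_zero.mpr hAB.symm
  have hf : C - B ≠ 0 := sub_ne_zero.mpr hBC.symm
  have hE : ‖B - A‖ ^ 2 ≠ 0 := pow_ne_zero _ (norm_ne_zero_iff.mpr he)
  have hF : ‖C - B‖ ^ 2 ≠ 0 := pow_ne_zero _ (norm_ne_zero_iff.mpr hf)
  have hI' : I = (1 / 2 : ℝ) • (A + C) := by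
    rw [hI, midpoint_eq_smul_add, invOf_eq_inv, one_div]
  have hA : A = framePoint I (B - A) (C - B) (-(1 / 2)) (-(1 / 2)) := by
    rw [framePoint, hI']
    module
  have hB : B = framePoint I (B - A) (C - B) (1 / 2) (-(1 / 2)) := by
    rw [framePoint, hI']
    module
  have hC : C = framePoint I (B - A) (C - B) (1 / 2) (1 / 2) := by
    rw [framePoint, hI']
    module
  have hD : D = framePoint I (B - A) (C - B) (-(1 / 2)) (1 / 2) := by
    rw [framePoint, hI', eq_add_of_sub_eq hpar.symm]
    module
  clear hI hI' hpar hAB hBC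
  generalize B - A = e at *
  generalize C - B = f at *
  obtain ⟨p, q, rfl⟩ := exists_eq_framePoint he hf hperp I P
  obtain ⟨xa, ya, rfl⟩ := exists_eq_framePoint he hf hperp I Na
  obtain ⟨xb, yb, rfl⟩ := exists_eq_framePoint he hf hperp I Nb
  obtain ⟨xc, yc, rfl⟩ := exists_eq_framePoint he hf hperp I Nc
  obtain ⟨xd, yd, rfl⟩ := exists_eq_framePoint he hf hperp I Nd
  obtain ⟨x, y, rfl⟩ := exists_eq_framePoint he hf hperp I Q
  subst hA hB hC hD hM hN
  have hqa : q + 1 / 2 ≠ 0 := fun h => ne_lineMap_of_affineIndependent h₁ (p + 1 / 2) <| by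
    rw [lineMap_framePoint]
    congr 1 <;> linarith
  have hpb : p - 1 / 2 ≠ 0 := fun h => ne_lineMap_of_affineIndependent h₂ (q + 1 / 2) <| by
    rw [lineMap_framePoint]
    congr 1 <;> linarith
  have hqc : q - 1 / 2 ≠ 0 := fun h => ne_lineMap_of_affineIndependent h₃ (1 / 2 - p) <| by
    rw [lineMap_framePoint]
    congr 1 <;> linarith
  have hpd : p + 1 / 2 ≠ 0 := fun h => ne_lineMap_of_affineIndependent h₄ (1 / 2 - q) <| by
    rw [lineMap_framePoint]
    congr 1 <;> linarith
  simp only [IsNinePointCenter, midpoint_framePoint, dist_framePoint_eq_iff hperp]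
    at hNa hNb hNc hNd hQ₁ hQ₂ ⊢
  generalize ‖e‖ ^ 2 = E at *
  generalize ‖f‖ ^ 2 = F at *
  obtain ⟨rfl, ha⟩ := ninePointCenter_coordinates (p := p) (q := q) (s := -(1 / 2))
    (x := xa) (y := ya) (F := F) hE (by linear_combination hNa.2) (by linear_combination hNa.1)
  obtain ⟨rfl, hc⟩ := ninePointCenter_coordinates (p := p) (q := q) (s := 1 / 2)
    (x := xc) (y := yc) (F := F) hE (by linear_combination hNc.1) (by linear_combination hNc.2)
  obtain ⟨rfl, hb⟩ := ninePointCenter_coordinates (p := q) (q := p) (s := 1 / 2)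
    (x := yb) (y := xb) (F := E) hF (by linear_combination hNb.2) (by linear_combination hNb.1)
  obtain ⟨rfl, hd⟩ := ninePointCenter_coordinates (p := q) (q := p) (s := -(1 / 2))
    (x := yd) (y := xd) (F := E) hF (by linear_combination hNd.1) (by linear_combination hNd.2)
  have hy : y = (ya + yc) / 2 := by
    have hne : ya - yc ≠ 0 := fun h => hNac (by rw [sub_eq_zero.mp h])
    exact mul_left_cancel₀ (mul_ne_zero hF hne) (by linear_combination -hQ₁ / 2)
  have hx : x = (xd + xb) / 2 := by
    have hne : xb - xd ≠ 0 := fun h => hNbd (by rw [sub_eq_zero.mp h])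
    exact mul_left_cancel₀ (mul_ne_zero hE hne) (by linear_combination -hQ₂ / 2)
  have hm := ninePointCenter_mean ha hc
  have hn := ninePointCenter_mean hd hb
  rw [← hy] at hm
  rw [← hx] at hn
  have hu : E * (p ^ 2 - 1 / 4) ≠ 0 := by
    rw [show p ^ 2 - 1 / 4 = (p + 1 / 2) * (p - 1 / 2) by ring]
    exact mul_ne_zero hE (mul_ne_zero hpd hpb)
  have hv : F * (q ^ 2 - 1 / 4) ≠ 0 := by
    rw [show q ^ 2 - 1 / 4 = (q + 1 / 2) * (q - 1 / 2) by ring]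
    exact mul_ne_zero hF (mul_ne_zero hqa hqc)
  generalize E * (p ^ 2 - 1 / 4) = u at *
  generalize F * (q ^ 2 - 1 / 4) = v at *
  have huv : u - v ≠ 0 := by
    intro h
    obtain rfl := sub_eq_zero.mp h
    have hx0 : x = 0 := by simpa [hu] using hn
    have hy0 : y = 0 := by simpa [hv] using hm
    exact hIQ (by simp [framePoint, hx0, hy0])
  refine ⟨-(u + v) / (u - v), framePoint_smul_eq ?_ ?_⟩
  · rw [show (xb + xd) / 2 = x by linarith, div_mul_eq_mul_div, eq_div_iff huv]
    exact mul_left_cancel₀ hu (by linear_combination u / 2 * hn)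
  · rw [← hy, div_mul_eq_mul_div, eq_div_iff huv]
    exact mul_left_cancel₀ hv (by linear_combination v / 2 * hm)
end
end
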